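/- Fix integers 1 ≤ k < n. Then the dual polytope Δ(k,n)* := { y ∈ ℝ^{k(n−k)} : ⟨x,y⟩ ≥ −1 for all x ∈ Δ(k,n) } has exactly binomial(n,k) extreme points. (Equivalently, the codimension-one faces of Δ(k,n) are in bijection with the set A(k,n) of strictly increasing k-tuples of integers from {1,…,n}.) -/

import Mathlib

open Finset

/-- The standard basis vector `f_{i,j}` (with `0`-based indices `i,j`) of
`ℝ^{k(n-k)} = (Fin k × Fin (n-k)) → ℝ`. -/
def basisVec (k n : ℕ) (i j : ℕ) : Fin k × Fin (n - k) → ℝ :=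
  fun p => if (p.1 : ℕ) = i ∧ (p.2 : ℕ) = j then 1 else 0

/-- The set of defining vectors `{u_{i,j}} ∪ {v_{i,j}}` of the polytope `Δ(k,n)`
(in `0`-based indexing):
`u_{1,0} = f_{1,1}`;  `u_{i,j} = f_{i,j+1} - f_{i-1,j+1}` for `2 ≤ i ≤ k`, `0 ≤ j ≤ n-k-1`;
`v_{k,n-k} = -f_{k,n-k}`;  `v_{i,j} = f_{i,j+1} - f_{i,j}` for `1 ≤ i ≤ k`, `1 ≤ j ≤ n-k-1`. -/
def deltaVertices (k n : ℕ) : Set (Fin k × Fin (n - k) → ℝ) :=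
  {basisVec k n 0 0} ∪
    {x | ∃ i j : ℕ, 1 ≤ i ∧ i ≤ k - 1 ∧ j ≤ n - k - 1 ∧
      x = basisVec k n i j - basisVec k n (i - 1) j} ∪
    {-(basisVec k n (k - 1) (n - k - 1))} ∪
    {x | ∃ i j : ℕ, i ≤ k - 1 ∧ 1 ≤ j ∧ j ≤ n - k - 1 ∧
      x = basisVec k n i j - basisVec k n i (j - 1)}

/-- The polytope `Δ(k,n) ⊂ ℝ^{k(n-k)}`, the convex hull of the `u_{i,j}` and `v_{i,j}`. -/
noncomputable def deltaPoly (k n : ℕ) : Set (Fin k × Fin (n - k) → ℝ) :=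
  convexHull ℝ (deltaVertices k n)

/-- The dual polytope `Δ(k,n)* = { y : ⟨x,y⟩ ≥ -1 for all x ∈ Δ(k,n) }`. -/
noncomputable def deltaPolyDual (k n : ℕ) : Set (Fin k × Fin (n - k) → ℝ) :=
  {y | ∀ x ∈ deltaPoly k n, (∑ p, x p * y p) ≥ -1}

lemma sum_basisVec_mul {k n i j : ℕ} (hi : i < k) (hj : j < n - k)
    (y : Fin k × Fin (n - k) → ℝ) :
    ∑ p, basisVec k n i j p * y p = y (⟨i, hi⟩, ⟨j, hj⟩) := by
  rw [Finset.sum_eq_single (⟨i, hi⟩, ⟨j, hj⟩)]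
  · simp [basisVec]
  · intro p _ hp
    have : ¬ ((p.1 : ℕ) = i ∧ (p.2 : ℕ) = j) := fun h =>
      hp (Prod.ext (Fin.ext h.1) (Fin.ext h.2))
    simp [basisVec, this]
  · simp

lemma Fin.monotone_of_le_add_one {N : ℕ} {f : Fin N → ℝ}
    (h : ∀ (i : ℕ) (hi : i + 1 < N), f ⟨i, by omega⟩ ≤ f ⟨i + 1, hi⟩) : Monotone f := by
  cases N with
  | zero => exact fun a => a.elim0
  | succ N => exact Fin.monotone_iff_le_succ.2 fun i => h i (by omega)

lemma mem_deltaPolyDual_iff_vertices {k n : ℕ} {y : Fin k × Fin (n - k) → ℝ} :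
    y ∈ deltaPolyDual k n ↔ ∀ x ∈ deltaVertices k n, -1 ≤ ∑ p, x p * y p := by
  refine ⟨fun h x hx => h x (subset_convexHull ℝ _ hx), fun h x hx => ?_⟩
  have hconv : Convex ℝ {x : Fin k × Fin (n - k) → ℝ | -1 ≤ ∑ p, x p * y p} := by
    intro a ha b hb s t hs ht hst
    have hsum : ∑ p, (s • a + t • b) p * y p = s * ∑ p, a p * y p + t * ∑ p, b p * y p := by
      rw [Finset.mul_sum, Finset.mul_sum, ← Finset.sum_add_distrib]
      refine Finset.sum_congr rfl fun p _ => ?_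
      simp only [Pi.add_apply, Pi.smul_apply, smul_eq_mul]
      ring
    simp only [Set.mem_ofPred_eq] at ha hb ⊢
    rw [hsum]
    nlinarith [mul_le_mul_of_nonneg_left ha hs, mul_le_mul_of_nonneg_left hb ht]
  exact convexHull_min (fun x hx => h x hx) hconv hx

/-- Translation by `cellRank k n` carries the dual polytope to a dilated order polytope. -/
def cellRank (k n : ℕ) : Fin k × Fin (n - k) → ℝ :=
  fun p => (p.1 : ℕ) + (p.2 : ℕ) + 1

lemma mem_deltaPolyDual_iff {k n : ℕ} (hk : 1 ≤ k) (hkn : k < n)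
    {y : Fin k × Fin (n - k) → ℝ} :
    y ∈ deltaPolyDual k n ↔
      Monotone (y + cellRank k n) ∧ ∀ p, (y + cellRank k n) p ∈ Set.Icc (0 : ℝ) n := by
  have hk0 : 0 < k := hk
  have hm0 : 0 < n - k := by omega
  have hnR : ((n - k - 1 : ℕ) : ℝ) = n - k - 1 := by
    rw [Nat.cast_sub (by omega), Nat.cast_sub hkn.le]; simp
  have hkR : ((k - 1 : ℕ) : ℝ) = k - 1 := by
    rw [Nat.cast_sub hk]; simp
  rw [mem_deltaPolyDual_iff_vertices]
  constructor
  · intro h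
    have hmono : Monotone (y + cellRank k n) := by
      have hrow : ∀ b, Monotone fun a => (y + cellRank k n) (a, b) := by
        intro b
        refine Fin.monotone_of_le_add_one fun i hi => ?_
        have := h (basisVec k n (i + 1) b - basisVec k n (i + 1 - 1) b)
          (Or.inl (Or.inl (Or.inr ⟨i + 1, b, by omega, by omega, by omega, rfl⟩)))
        simp only [Pi.sub_apply, sub_mul, Finset.sum_sub_distrib, Nat.add_sub_cancel] at this
        rw [sum_basisVec_mul hi b.2, sum_basisVec_mul (by omega) b.2] at this
        simp only [Pi.add_apply, cellRank, Fin.eta] at this ⊢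
        push_cast
        linarith
      have hcol : ∀ a, Monotone fun b => (y + cellRank k n) (a, b) := by
        intro a
        refine Fin.monotone_of_le_add_one fun j hj => ?_
        have := h (basisVec k n a (j + 1) - basisVec k n a (j + 1 - 1))
          (Or.inr ⟨a, j + 1, by omega, by omega, by omega, rfl⟩)
        simp only [Pi.sub_apply, sub_mul, Finset.sum_sub_distrib, Nat.add_sub_cancel] at this
        rw [sum_basisVec_mul a.2 hj, sum_basisVec_mul a.2 (by omega)] at this
        simp only [Pi.add_apply, cellRank, Fin.eta] at this ⊢
        push_cast
        linarith
      exact fun p q hpq => (hrow p.2 hpq.1).trans (hcol q.1 hpq.2)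
    refine ⟨hmono, fun p => ⟨?_, ?_⟩⟩
    · have h0 := h (basisVec k n 0 0) (Or.inl (Or.inl (Or.inl rfl)))
      rw [sum_basisVec_mul hk0 hm0] at h0
      have hle : ((⟨0, hk0⟩, ⟨0, hm0⟩) : Fin k × Fin (n - k)) ≤ p :=
        ⟨Fin.mk_le_of_le_val (Nat.zero_le _), Fin.mk_le_of_le_val (Nat.zero_le _)⟩
      have := hmono hle
      refine le_trans ?_ this
      simp only [Pi.add_apply, cellRank, Nat.cast_zero]
      linarith
    · have h1 := h (-basisVec k n (k - 1) (n - k - 1)) (Or.inl (Or.inr rfl))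
      simp only [Pi.neg_apply, neg_mul, Finset.sum_neg_distrib] at h1
      rw [sum_basisVec_mul (by omega) (by omega)] at h1
      have hle : p ≤ (⟨k - 1, by omega⟩, ⟨n - k - 1, by omega⟩) :=
        ⟨Fin.le_def.2 (by simp only; omega), Fin.le_def.2 (by simp only; omega)⟩
      refine (hmono hle).trans ?_
      simp only [Pi.add_apply, cellRank, hnR, hkR]
      linarith
  · rintro ⟨hmono, hbd⟩ x (((rfl | ⟨i, j, hi1, hi, hj, rfl⟩) | rfl) | ⟨i, j, hi, hj1, hj, rfl⟩)
    · rw [sum_basisVec_mul hk0 hm0]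
      have := (hbd (⟨0, hk0⟩, ⟨0, hm0⟩)).1
      simp only [Pi.add_apply, cellRank, Nat.cast_zero] at this
      linarith
    · obtain ⟨i, rfl⟩ := Nat.exists_eq_add_of_le' hi1
      simp only [Pi.sub_apply, sub_mul, Finset.sum_sub_distrib, Nat.add_sub_cancel]
      have hi' : i + 1 < k := by omega
      have hj' : j < n - k := by omega
      rw [sum_basisVec_mul hi' hj', sum_basisVec_mul (by omega) hj']
      have hle : ((⟨i, by omega⟩, ⟨j, hj'⟩) : Fin k × Fin (n - k)) ≤ (⟨i + 1, hi'⟩, ⟨j, hj'⟩) :=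
        ⟨Fin.le_def.2 (Nat.le_succ i), le_rfl⟩
      have := hmono hle
      simp only [Pi.add_apply, cellRank] at this
      push_cast at this
      linarith
    · simp only [Pi.neg_apply, neg_mul, Finset.sum_neg_distrib]
      rw [sum_basisVec_mul (by omega) (by omega)]
      have := (hbd (⟨k - 1, by omega⟩, ⟨n - k - 1, by omega⟩)).2
      simp only [Pi.add_apply, cellRank, hnR, hkR] at this
      linarith
    · obtain ⟨j, rfl⟩ := Nat.exists_eq_add_of_le' hj1
      simp only [Pi.sub_apply, sub_mul, Finset.sum_sub_distrib, Nat.add_sub_cancel]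
      have hi' : i < k := by omega
      have hj' : j + 1 < n - k := by omega
      rw [sum_basisVec_mul hi' hj', sum_basisVec_mul hi' (by omega)]
      have hle : ((⟨i, hi'⟩, ⟨j, by omega⟩) : Fin k × Fin (n - k)) ≤ (⟨i, hi'⟩, ⟨j + 1, hj'⟩) :=
        ⟨le_rfl, Fin.le_def.2 (Nat.le_succ j)⟩
      have := hmono hle
      simp only [Pi.add_apply, cellRank] at this
      push_cast at this
      linarith

/-- The extreme points of a translated and dilated order polytope are the vertices with
coordinates `0` and `c` (before translation). -/
lemma extremePoints_orderPolytope {α : Type*} [Preorder α] (r : α → ℝ) {c : ℝ} (hc : 0 < c) :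
    Set.extremePoints ℝ {y : α → ℝ | Monotone (y + r) ∧ ∀ p, (y + r) p ∈ Set.Icc 0 c} =
      {y | Monotone (y + r) ∧ ∀ p, (y + r) p = 0 ∨ (y + r) p = c} := by
  ext y
  rw [mem_extremePoints_iff_left]
  constructor
  · rintro ⟨⟨hmono, hbd⟩, hext⟩
    refine ⟨hmono, fun p => ?_⟩
    -- `t` is the midpoint of the monotone self-maps `t² / c` and `2 t - t² / c` of `[0, c]`.
    have key := hext (fun p => (y + r) p ^ 2 / c - r p) ?_
      (fun p => 2 * (y + r) p - (y + r) p ^ 2 / c - r p) ?_ ?_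
    · have hp : (y + r) p ^ 2 / c - r p = y p := congrFun key p
      have hz : (y + r) p = y p + r p := rfl
      have : (y + r) p ^ 2 = (y + r) p * c := by
        rw [← div_eq_iff hc.ne']
        linarith
      have h0 : (y + r) p * ((y + r) p - c) = 0 := by linear_combination this
      rcases mul_eq_zero.1 h0 with h | h
      · exact Or.inl h
      · exact Or.inr (sub_eq_zero.1 h)
    · refine ⟨fun a b hab => ?_, fun a => ?_⟩
      · have h1 := hmono hab
        have h2 := (hbd a).1
        simp only [Pi.add_apply, sub_add_cancel] at h1 h2 ⊢
        gcongr
      · obtain ⟨h1, h2⟩ := hbd a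
        have : ((fun p => (y + r) p ^ 2 / c - r p) + r) a = (y + r) a ^ 2 / c := by simp
        rw [this]
        refine ⟨by positivity, ?_⟩
        rw [div_le_iff₀ hc]
        nlinarith
    · refine ⟨fun a b hab => ?_, fun a => ?_⟩
      · have h1 := hmono hab
        have h2 := (hbd a).2
        have h3 := (hbd b).2
        simp only [Pi.add_apply, sub_add_cancel] at h1 h2 h3 ⊢
        have : (y b + r b) ^ 2 / c - (y a + r a) ^ 2 / c
            ≤ 2 * (y b + r b) - 2 * (y a + r a) := by
          rw [← sub_div, div_le_iff₀ hc]
          nlinarith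
        linarith
      · obtain ⟨h1, h2⟩ := hbd a
        have : ((fun p => 2 * (y + r) p - (y + r) p ^ 2 / c - r p : α → ℝ) + r) a
            = 2 * (y + r) a - (y + r) a ^ 2 / c := by simp
        rw [this]
        have h3 : (y + r) a ^ 2 / c ≤ (y + r) a := by
          rw [div_le_iff₀ hc]
          nlinarith
        have h4 : 2 * (y + r) a - c ≤ (y + r) a ^ 2 / c := by
          rw [le_div_iff₀ hc]
          nlinarith [sq_nonneg ((y + r) a - c)]
        exact ⟨by linarith, by linarith⟩
    · refine ⟨1 / 2, 1 / 2, by norm_num, by norm_num, by norm_num, ?_⟩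
      ext q
      simp only [Pi.add_apply, Pi.smul_apply, smul_eq_mul]
      ring
  · rintro ⟨hmono, hval⟩
    refine ⟨⟨hmono, fun p => ?_⟩, ?_⟩
    · rcases hval p with h | h <;> rw [h] <;> simp [hc.le]
    · rintro a ⟨-, ha⟩ b ⟨-, hb⟩ ⟨s, t, hs, ht, hst, rfl⟩
      ext p
      obtain ⟨ha1, ha2⟩ := ha p
      obtain ⟨hb1, hb2⟩ := hb p
      have hv := hval p
      simp only [Pi.add_apply, Pi.smul_apply, smul_eq_mul] at ha1 ha2 hb1 hb2 hv ⊢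
      have ht' : t = 1 - s := by linarith
      subst ht'
      have e : s * a p + (1 - s) * b p + r p = s * (a p + r p) + (1 - s) * (b p + r p) := by ring
      have ha' : a p + r p = s * a p + (1 - s) * b p + r p := by
        rcases hv with h | h
        · rw [h]
          have := mul_nonneg ht.le hb1
          have := mul_nonneg hs.le ha1
          have : s * (a p + r p) = 0 := by linarith
          exact (mul_eq_zero.1 this).resolve_left hs.ne'
        · rw [h]
          have := mul_le_mul_of_nonneg_left hb2 ht.le
          have := mul_le_mul_of_nonneg_left ha2 hs.le
          have : s * (a p + r p) = s * c := by linarith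
          exact mul_left_cancel₀ hs.ne' this
      linarith

/-- An upper set in `Fin m` is the final segment of its cardinality. -/
lemma Fin.mem_iff_le_add_card_of_isUpperSet {m : ℕ} {s : Finset (Fin m)}
    (hs : IsUpperSet (s : Set (Fin m))) (j : Fin m) : j ∈ s ↔ m ≤ j + s.card := by
  constructor
  · intro hj
    have : Finset.Ici j ⊆ s := fun i hi => hs (Finset.mem_Ici.1 hi) hj
    have := Finset.card_le_card this
    rw [Fin.card_Ici] at this
    omega
  · intro h
    by_contra hj
    have : s ⊆ Finset.Ioi j := fun i hi =>
      Finset.mem_Ioi.2 (lt_of_not_ge fun hij => hj (hs hij hi))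
    have := Finset.card_le_card this
    rw [Fin.card_Ioi] at this
    omega

lemma Fin.val_le_of_orderEmbedding {k n : ℕ} (a : Fin k ↪o Fin n) (i : Fin k) :
    (i : ℕ) ≤ a i ∧ (a i : ℕ) + k ≤ n + i := by
  have h1 := Finset.card_le_card (Finset.map_subset_iff_subset_preimage.2
    (fun j hj => by simpa using hj : Finset.Iio i ⊆ (Finset.Iio (a i)).preimage a
      a.injective.injOn) : (Finset.Iio i).map a.toEmbedding ⊆ Finset.Iio (a i))
  have h2 := Finset.card_le_card (Finset.map_subset_iff_subset_preimage.2
    (fun j hj => by simpa using hj : Finset.Ioi i ⊆ (Finset.Ioi (a i)).preimage a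
      a.injective.injOn) : (Finset.Ioi i).map a.toEmbedding ⊆ Finset.Ioi (a i))
  rw [Finset.card_map, Fin.card_Iio, Fin.card_Iio] at h1
  rw [Finset.card_map, Fin.card_Ioi, Fin.card_Ioi] at h2
  omega

/-- The extreme point of the dual polytope attached to an increasing `k`-tuple. -/
noncomputable def dualVertex (k n : ℕ) (a : Fin k ↪o Fin n) : Fin k × Fin (n - k) → ℝ :=
  fun p => (if n - k + p.1 ≤ p.2 + a p.1 then (n : ℝ) else 0) - cellRank k n p

lemma dualVertex_add_cellRank {k n : ℕ} (a : Fin k ↪o Fin n) (p : Fin k × Fin (n - k)) :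
    (dualVertex k n a + cellRank k n) p = if n - k + p.1 ≤ p.2 + a p.1 then (n : ℝ) else 0 := by
  simp [dualVertex]

lemma dualVertex_injective {k n : ℕ} (hkn : k < n) : Function.Injective (dualVertex k n) := by
  have hn : (n : ℝ) ≠ 0 := Nat.cast_ne_zero.2 (by omega)
  intro a b hab
  have hiff : ∀ (i : Fin k) (j : Fin (n - k)),
      n - k + i ≤ j + (a i : ℕ) ↔ n - k + i ≤ j + (b i : ℕ) := by
    intro i j
    have := dualVertex_add_cellRank a (i, j)
    rw [hab, dualVertex_add_cellRank] at this
    simp only at this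
    split_ifs at this with h2 h1 h1
    · exact iff_of_true h1 h2
    · exact absurd this hn
    · exact absurd this.symm hn
    · exact iff_of_false h1 h2
  have hle : ∀ (i : Fin k) (x y : Fin k ↪o Fin n),
      (∀ j : Fin (n - k), n - k + i ≤ j + (x i : ℕ) → n - k + i ≤ j + (y i : ℕ)) →
      (x i : ℕ) ≤ y i := by
    intro i x y h
    obtain ⟨hx1, hx2⟩ := Fin.val_le_of_orderEmbedding x i
    obtain ⟨hy1, hy2⟩ := Fin.val_le_of_orderEmbedding y i
    by_contra! hlt
    have := h ⟨n - k + i - x i, by omega⟩ (by simp only; omega)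
    simp only at this
    omega
  ext i
  exact le_antisymm (hle i a b fun j => (hiff i j).1) (hle i b a fun j => (hiff i j).2)

lemma range_dualVertex {k n : ℕ} (hkn : k < n) :
    Set.range (dualVertex k n) = {y | Monotone (y + cellRank k n) ∧
      ∀ p, (y + cellRank k n) p = 0 ∨ (y + cellRank k n) p = n} := by
  have hn : (0 : ℝ) < n := Nat.cast_pos.2 (by omega)
  ext y
  constructor
  · rintro ⟨a, rfl⟩
    refine ⟨fun p q hpq => ?_, fun p => ?_⟩
    · rw [dualVertex_add_cellRank, dualVertex_add_cellRank]
      have hgap : (a p.1 : ℕ) + q.1 ≤ a q.1 + p.1 := by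
        have hmono : ∀ d : ℕ, ∀ i j : Fin k, (j : ℕ) = i + d → (a i : ℕ) + d ≤ a j := by
          intro d
          induction d with
          | zero => intro i j h; rw [show j = i from Fin.ext h]; simp
          | succ d ih =>
            intro i j h
            have h1 := ih i ⟨i + d, by omega⟩ rfl
            have h2 : a ⟨i + d, by omega⟩ < a j := a.strictMono (Fin.lt_def.2 (by simp only; omega))
            have := Fin.lt_def.1 h2
            omega
        have h1 : (p.1 : ℕ) ≤ q.1 := hpq.1
        have := hmono (q.1 - p.1) p.1 q.1 (by omega)
        omega
      have h2 : (p.2 : ℕ) ≤ q.2 := hpq.2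
      by_cases h : n - k + p.1 ≤ p.2 + (a p.1 : ℕ)
      · rw [if_pos h, if_pos (by omega)]
      · rw [if_neg h]
        split_ifs <;> simp
    · rw [dualVertex_add_cellRank]
      split_ifs <;> simp
  · rintro ⟨hmono, hval⟩
    classical
    let s : Fin k → Finset (Fin (n - k)) := fun i => {j | (y + cellRank k n) (i, j) = n}
    have hs : ∀ i i' j j', i ≤ i' → j ≤ j' → j ∈ s i → j' ∈ s i' := by
      intro i i' j j' hi hj h
      simp only [s, Finset.mem_filter_univ] at h ⊢
      have hle : (y + cellRank k n) (i, j) ≤ (y + cellRank k n) (i', j') := hmono ⟨hi, hj⟩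
      rcases hval (i', j') with h0 | h0
      · linarith
      · exact h0
    have hcard : ∀ i, (s i).card ≤ n - k := fun i => (Finset.card_le_univ _).trans (by simp)
    have hcmono : ∀ i i', i ≤ i' → (s i).card ≤ (s i').card := fun i i' hi =>
      Finset.card_le_card fun j hj => hs i i' j j hi le_rfl hj
    let a : Fin k ↪o Fin n := OrderEmbedding.ofStrictMono
      (fun i => ⟨i + (s i).card, by have := hcard i; omega⟩) (fun i i' hi => by
        have := hcmono i i' hi.le
        have h2 := Fin.lt_def.1 hi
        exact Fin.lt_def.2 (by simp only; omega))
    refine ⟨a, ?_⟩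
    have : dualVertex k n a + cellRank k n = y + cellRank k n := by
      ext ⟨i, j⟩
      rw [dualVertex_add_cellRank]
      have hmem := Fin.mem_iff_le_add_card_of_isUpperSet (s := s i)
        (fun j j' hj h => hs i i j j' le_rfl hj h) j
      have ha : (a i : ℕ) = i + (s i).card := rfl
      simp only [ha]
      split_ifs with h
      · have := hmem.2 (by omega)
        simp only [s, Finset.mem_filter_univ] at this
        exact this.symm
      · refine ((hval (i, j)).resolve_right fun h' => h ?_).symm
        have := hmem.1 (by simpa only [s, Finset.mem_filter_univ] using h')
        omega
    exact add_right_cancel this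

/-- For `1 ≤ k < n`, the dual polytope `Δ(k,n)*` has exactly `binomial(n,k)` extreme
points; equivalently, the codimension-one faces of `Δ(k,n)` are in bijection with the set
`A(k,n)` of strictly increasing `k`-tuples from `{1,…,n}`, whose cardinality is
`binomial(n,k)`. -/
theorem stmt_1 (k n : ℕ) (hk : 1 ≤ k) (hkn : k < n) :
    (Set.extremePoints ℝ (deltaPolyDual k n)).ncard = n.choose k := by
  have hdual : deltaPolyDual k n = {y | Monotone (y + cellRank k n) ∧
      ∀ p, (y + cellRank k n) p ∈ Set.Icc (0 : ℝ) n} :=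
    Set.ext fun y => mem_deltaPolyDual_iff hk hkn
  rw [hdual, extremePoints_orderPolytope _ (Nat.cast_pos.2 (by omega)), ← range_dualVertex hkn,
    Set.ncard_range_of_injective (dualVertex_injective hkn),
    Nat.card_congr Set.powersetCard.ofFinEmbEquiv, Set.powersetCard.card, Nat.card_fin]
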